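/- Let h:ℝ^d→ℝ admit, for an index i, a decomposition h(x₁,…,x_d) = h²(x_i, h^{d−1}(x₁,…,x_{i−1},x_{i+1},…,x_d)) with h²:ℝ²→ℝ supermodular and increasing in each component. Let X̃ be an n×d real matrix whose i-th column x̃^(i) is not oppositely ordered to the vector v = h^{d−1}(X̃_{−i}) ∈ ℝⁿ (obtained by applying h^{d−1} to each row of X̃ with the i-th column removed), and let X̂ be the matrix obtained from X̃ by rearranging the entries of the i-th column so that the new column is oppositely ordered to v (leaving all other columns unchanged). Then h(X̂) ≺_w h(X̃), where h(M) denotes the vector in ℝⁿ obtained by applying h to each row of M. -/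

import Mathlib

/-- Decreasing rearrangement of a vector. -/
noncomputable def decSort {n : ℕ} (x : Fin n → ℝ) : Fin n → ℝ :=
  fun i => x (Tuple.sort x i.rev)

/-- Increasing rearrangement of a vector. -/
noncomputable def incSort {n : ℕ} (x : Fin n → ℝ) : Fin n → ℝ :=
  fun i => x (Tuple.sort x i)

/-- Sum of the `k` largest components. -/
noncomputable def topSum {n : ℕ} (k : ℕ) (x : Fin n → ℝ) : ℝ :=
  ∑ i ∈ Finset.univ.filter (fun i : Fin n => (i : ℕ) < k), decSort x i

/-- Sum of the `k` smallest components. -/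
noncomputable def botSum {n : ℕ} (k : ℕ) (x : Fin n → ℝ) : ℝ :=
  ∑ i ∈ Finset.univ.filter (fun i : Fin n => (i : ℕ) < k), incSort x i

/-- `x ≺ y` : majorization. -/
def Maj {n : ℕ} (x y : Fin n → ℝ) : Prop :=
  (∀ k < n, topSum k x ≤ topSum k y) ∧ (∑ i, x i = ∑ i, y i)

/-- `x ≺_w y` : weak submajorization. -/
def WSubMaj {n : ℕ} (x y : Fin n → ℝ) : Prop :=
  ∀ k ≤ n, topSum k x ≤ topSum k y

/-- `x ≺^w y` : weak supermajorization. -/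
def WSupMaj {n : ℕ} (x y : Fin n → ℝ) : Prop :=
  ∀ k ≤ n, botSum k y ≤ botSum k x

/-- Schur-convexity. -/
def SchurConvex {n : ℕ} (φ : (Fin n → ℝ) → ℝ) : Prop :=
  ∀ x y, Maj x y → φ x ≤ φ y

/-- `Y` is obtained from `X` by permuting the entries within each column. -/
def InPermSet {n d : ℕ} (X Y : Fin n → Fin d → ℝ) : Prop :=
  ∀ i : Fin d, ∃ π : Equiv.Perm (Fin n), ∀ k, Y k i = X (π k) i

/-- `x` and `y` are oppositely ordered. -/
def OppOrd {n : ℕ} (x y : Fin n → ℝ) : Prop :=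
  ∀ k l, (x k - x l) * (y k - y l) ≤ 0

/-- Supermodularity for functions of two real variables. -/
def Supermod2 (h : ℝ → ℝ → ℝ) : Prop :=
  ∀ a a' b b', h a b + h a' b' ≤ h (min a a') (min b b') + h (max a a') (max b b')

/-- Supermodularity for functions on `ℝ^m`. -/
def SupermodPi {m : ℕ} (h : (Fin m → ℝ) → ℝ) : Prop :=
  ∀ x y, h x + h y ≤ h (x ⊓ y) + h (x ⊔ y)

/-- `h` is strictly monotone in each component. -/
def StrictCompMono {m : ℕ} (h : (Fin m → ℝ) → ℝ) : Prop :=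
  ∀ i : Fin m,
    (∀ x : Fin m → ℝ, StrictMono fun t => h (Function.update x i t)) ∨
    (∀ x : Fin m → ℝ, StrictAnti fun t => h (Function.update x i t))

/-- Rearrangement inequality for supermodular functions: among all pairings of two vectors, the
oppositely ordered one minimizes the sum of a supermodular function. -/
theorem Supermod2.sum_le_sum_comp_perm {ι : Type*} {w : ℝ → ℝ → ℝ} (hw : Supermod2 w)
    {f g : ι → ℝ} {s : Finset ι} (hfg : AntivaryOn f g s) {σ : Equiv.Perm ι}
    (hσ : {x | σ x ≠ x} ⊆ s) :
    ∑ i ∈ s, w (f i) (g i) ≤ ∑ i ∈ s, w (f (σ i)) (g i) := by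
  classical
  induction s using Finset.induction_on_max_value
    (fun i => toLex (g i, -f i)) generalizing σ with
  | empty => simp
  | insert a s has hmax ih =>
    set τ : Equiv.Perm ι := σ.trans (Equiv.swap a (σ a)) with hτ
    have hτs : {x | τ x ≠ x} ⊆ (s : Set ι) := by
      intro x hx
      simp only [τ, Ne, Set.mem_ofPred_eq, Equiv.swap_comp_apply] at hx
      split_ifs at hx with h₁ h₂
      · obtain rfl | hax := eq_or_ne x a
        · contradiction
        · exact Finset.mem_of_mem_insert_of_ne (hσ fun h => hax <| h.symm.trans h₁) hax
      · exact (hx <| σ.injective h₂.symm).elim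
      · exact Finset.mem_of_mem_insert_of_ne (hσ hx) (ne_of_apply_ne _ h₂)
    specialize ih (hfg.subset (by simp)) hτs
    rw [Finset.sum_insert has, Finset.sum_insert has]
    obtain hσa | hσa := eq_or_ne (σ a) a
    · have : τ = σ := by rw [hτ, hσa, Equiv.swap_self, Equiv.trans_refl]
      rw [this] at ih
      rw [hσa]
      gcongr
    have h1s : σ.symm a ∈ s := by
      have hne : σ.symm a ≠ a := fun h => hσa (σ.symm_apply_eq.1 h).symm
      refine Finset.mem_of_mem_insert_of_ne (hσ fun h => hne ?_) hne
      rwa [Equiv.apply_symm_apply, eq_comm] at h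
    have h2s : σ a ∈ s :=
      Finset.mem_of_mem_insert_of_ne (hσ fun h => hσa <| σ.injective h) hσa
    have hg : g (σ.symm a) ≤ g a := by
      obtain h | h := Prod.Lex.toLex_le_toLex.1 (hmax _ h1s)
      · exact h.le
      · exact h.1.le
    have hf : f a ≤ f (σ a) := by
      obtain h | h := Prod.Lex.toLex_le_toLex.1 (hmax _ h2s)
      · exact hfg (by simp [h2s]) (by simp) h
      · exact neg_le_neg_iff.1 h.2
    have hswap := hw (f (σ a)) (f a) (g (σ.symm a)) (g a)
    rw [min_eq_right hf, max_eq_left hf, min_eq_left hg, max_eq_right hg] at hswap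
    have hrest : ∑ i ∈ s.erase (σ.symm a), w (f (τ i)) (g i) =
        ∑ i ∈ s.erase (σ.symm a), w (f (σ i)) (g i) := by
      refine Finset.sum_congr rfl fun x hx => ?_
      obtain ⟨hx1, hxs⟩ := Finset.mem_erase.1 hx
      have : τ x = σ x := Equiv.swap_apply_of_ne_of_ne
        (fun h => hx1 (σ.eq_symm_apply.2 h)) (fun h => has (σ.injective h ▸ hxs))
      rw [this]
    have hτa : τ (σ.symm a) = σ a := by simp [τ]
    rw [← Finset.add_sum_erase _ (fun i => w (f (τ i)) (g i)) h1s, hrest, hτa] at ih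
    rw [← Finset.add_sum_erase _ (fun i => w (f (σ i)) (g i)) h1s, Equiv.apply_symm_apply]
    linarith

/-- The positive part of a shift of a componentwise increasing supermodular function is
supermodular. -/
theorem Supermod2.max_sub_zero {w : ℝ → ℝ → ℝ} (hw : Supermod2 w)
    (h1 : ∀ b, Monotone fun a => w a b) (h2 : ∀ a, Monotone fun b => w a b) (t : ℝ) :
    Supermod2 fun a b => max (w a b - t) 0 := by
  intro a a' b b'
  have hmono {p q r s : ℝ} (hpq : p ≤ q) (hrs : r ≤ s) : w p r ≤ w q s :=
    (h1 r hpq).trans (h2 q hrs)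
  have hle : w a b ≤ w (max a a') (max b b') := hmono (le_max_left _ _) (le_max_left _ _)
  have hle' : w a' b' ≤ w (max a a') (max b b') := hmono (le_max_right _ _) (le_max_right _ _)
  have hsum := hw a a' b b'
  dsimp only
  generalize w (max a a') (max b b') = M at *
  generalize w (min a a') (min b b') = m at *
  obtain h | h := max_cases (w a b - t) 0 <;> obtain h' | h' := max_cases (w a' b' - t) 0 <;>
  linarith [le_max_left (M - t) 0, le_max_right (M - t) 0, le_max_left (m - t) 0,
    le_max_right (m - t) 0]

theorem decSort_antitone {n : ℕ} (x : Fin n → ℝ) : Antitone (decSort x) :=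
  fun _ _ h => Tuple.monotone_sort x (Fin.rev_le_rev.2 h)

theorem sum_comp_decSort {n : ℕ} (φ : ℝ → ℝ) (x : Fin n → ℝ) :
    ∑ i, φ (decSort x i) = ∑ i, φ (x i) :=
  Equiv.sum_comp (Fin.revPerm.trans (Tuple.sort x)) fun i => φ (x i)

theorem topSum_eq_add_sum_sub {n k : ℕ} (hk : k ≤ n) (x : Fin n → ℝ) (t : ℝ) :
    topSum k x = k * t +
      ∑ i ∈ Finset.univ.filter (fun i : Fin n => (i : ℕ) < k), (decSort x i - t) := by
  rw [Finset.sum_sub_distrib, Finset.sum_const, Fin.card_filter_val_lt, min_eq_right hk,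
    nsmul_eq_mul, topSum]
  ring

theorem topSum_le {n k : ℕ} (hk : k ≤ n) (x : Fin n → ℝ) (t : ℝ) :
    topSum k x ≤ k * t + ∑ i, max (x i - t) 0 := by
  rw [topSum_eq_add_sum_sub hk x t, ← sum_comp_decSort (fun y => max (y - t) 0) x]
  refine add_le_add le_rfl ((Finset.sum_le_sum fun i _ => le_max_left _ 0).trans ?_)
  exact Finset.sum_le_sum_of_subset_of_nonneg (Finset.filter_subset _ _)
    fun i _ _ => le_max_right _ _

theorem exists_topSum_eq {n k : ℕ} (hk0 : 0 < k) (hk : k ≤ n) (x : Fin n → ℝ) :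
    ∃ t, topSum k x = k * t + ∑ i, max (x i - t) 0 := by
  let j : Fin n := ⟨k - 1, by omega⟩
  refine ⟨decSort x j, ?_⟩
  rw [topSum_eq_add_sum_sub hk x (decSort x j),
    ← sum_comp_decSort (fun y => max (y - decSort x j) 0) x, Finset.sum_filter]
  congr 1
  refine Finset.sum_congr rfl fun i _ => ?_
  split_ifs with hi
  · have : decSort x j ≤ decSort x i := decSort_antitone x (Fin.le_def.2 (by simp [j]; omega))
    rw [max_eq_left (sub_nonneg.2 this)]
  · have : decSort x i ≤ decSort x j := decSort_antitone x (Fin.le_def.2 (by simp [j]; omega))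
    rw [max_eq_right (sub_nonpos.2 this)]

theorem wSubMaj_of_sum_max_le {n : ℕ} {x y : Fin n → ℝ}
    (hxy : ∀ t, ∑ i, max (x i - t) 0 ≤ ∑ i, max (y i - t) 0) : WSubMaj x y := by
  intro k hk
  obtain rfl | hk0 := k.eq_zero_or_pos
  · simp [topSum]
  · obtain ⟨t, ht⟩ := exists_topSum_eq hk0 hk y
    rw [ht]
    exact (topSum_le hk x t).trans (add_le_add le_rfl (hxy t))

theorem OppOrd.antivary {n : ℕ} {x y : Fin n → ℝ} (h : OppOrd x y) : Antivary x y := by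
  intro k l hkl
  by_contra! hlt
  exact absurd (h l k) (not_le.2 (mul_pos (by linarith) (by linarith)))

/-- key step of the proof of the main theorem: rearranging the `i`-th
column of `X̃` to be oppositely ordered to `v = h^{d-1}(X̃₋ᵢ)` produces a matrix `X̂` with
`h(X̂) ≺_w h(X̃)`, whenever `h` decomposes at index `i` with `h²` supermodular and increasing
in each component. (Here the dimension is `d+1`.) -/
theorem stmt16 {n d : ℕ} (h : (Fin (d + 1) → ℝ) → ℝ)
    (h2 : ℝ → ℝ → ℝ) (hd1 : (Fin d → ℝ) → ℝ) (i : Fin (d + 1))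
    (hdec : ∀ x : Fin (d + 1) → ℝ, h x = h2 (x i) (hd1 fun j => x (i.succAbove j)))
    (hsm : Supermod2 h2)
    (hmono1 : ∀ b, Monotone fun a => h2 a b) (hmono2 : ∀ a, Monotone fun b => h2 a b)
    (Xt Xh : Fin n → Fin (d + 1) → ℝ)
    (v : Fin n → ℝ) (hv : v = fun k => hd1 fun j => Xt k (i.succAbove j))
    (hnot : ¬ OppOrd (fun k => Xt k i) v)
    (π : Equiv.Perm (Fin n))
    (hcol : ∀ k, Xh k i = Xt (π k) i)
    (hother : ∀ (k : Fin n) (j : Fin (d + 1)), j ≠ i → Xh k j = Xt k j)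
    (hopp : OppOrd (fun k => Xh k i) v) :
    WSubMaj (fun k => h (Xh k)) (fun k => h (Xt k)) := by
  have hXt : ∀ k, h (Xt k) = h2 (Xt k i) (v k) := fun k => by rw [hdec, hv]
  have hXh : ∀ k, h (Xh k) = h2 (Xh k i) (v k) := fun k => by
    simp only [hdec, hv, hother k _ (Fin.succAbove_ne i _)]
  refine wSubMaj_of_sum_max_le fun t => ?_
  have hperm := (hsm.max_sub_zero hmono1 hmono2 t).sum_le_sum_comp_perm (s := Finset.univ)
    (hopp.antivary.antivaryOn _) (σ := π.symm) (by simp)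
  simpa only [hXt, hXh, hcol, Equiv.apply_symm_apply] using hperm
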